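/- arXiv:0707.3754 — 4 statements merged into one kernel-verified Lean document; each statement's English description precedes it below -/
import Mathlib

section
/- Let F be a formally real field and let (A,σ) be a central simple F-algebra with involution of the first kind which is decomposable, i.e., (A,σ) ≅ (Q₁,σ₁) ⊗_F ⋯ ⊗_F (Q_r,σ_r) ⊗_F (M_s(F), t), where each Q_i is a quaternion division F-algebra with an involution σ_i of the first kind, s ≥ 1, and t is the transpose involution on M_s(F). Then (A,σ) is weakly isotropic if and only if (A,σ) is weakly hyperbolic. -/
open scoped TensorProduct

def IsFormallyRealField (F : Type*) [Field F] : Prop :=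
  ∀ (n : ℕ) (f : Fin n → F), ∑ i, f i ^ 2 ≠ -1

def IsFieldOrdering {F : Type*} [Field F] (P : Set F) : Prop :=
  (∀ x ∈ P, ∀ y ∈ P, x + y ∈ P) ∧ (∀ x ∈ P, ∀ y ∈ P, x * y ∈ P) ∧
    (∀ x : F, x ∈ P ∨ -x ∈ P) ∧ ∀ x : F, x ∈ P → -x ∈ P → x = 0

def IsRealClosedField (R : Type*) [Field R] : Prop :=
  IsFormallyRealField R ∧ (∀ x : R, IsSquare x ∨ IsSquare (-x)) ∧
    ∀ p : Polynomial R, Odd p.natDegree → ∃ x, p.eval x = 0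

def IsRealClosureAt (F R : Type*) [Field F] [Field R] [Algebra F R] (P : Set F) : Prop :=
  Algebra.IsAlgebraic F R ∧ IsRealClosedField R ∧
    ∀ x : F, IsSquare (algebraMap F R x) ↔ x ∈ P

def IsRealValuation {F : Type*} [Field F] (O : ValuationSubring F) : Prop :=
  IsFormallyRealField (IsLocalRing.ResidueField O)

/-- `σ` is an `F`-linear involution (anti-automorphism of order two), i.e. an involution of
the first kind on the `F`-algebra `A`. -/
def IsInvolutionFirstKind {F A : Type*} [CommSemiring F] [Ring A] [Algebra F A]
    (σ : A →ₗ[F] A) : Prop :=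
  (∀ x y : A, σ (x * y) = σ y * σ x) ∧ ∀ x : A, σ (σ x) = x

/-- `(A, σ)` is weakly isotropic: `σ(x₁)x₁ + ⋯ + σ(xₙ)xₙ = 0` for some `n ≥ 1` and
nonzero `x₁, …, xₙ`. -/
def InvWeaklyIsotropic {A : Type*} [Ring A] (σ : A → A) : Prop :=
  ∃ (n : ℕ) (x : Fin (n + 1) → A), (∀ i, x i ≠ 0) ∧ ∑ i, σ (x i) * x i = 0

/-- `(A, σ)` is isotropic: `σ(x)x = 0` for some nonzero `x`. -/
def InvIsotropic {A : Type*} [Ring A] (σ : A → A) : Prop :=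
  ∃ x : A, x ≠ 0 ∧ σ x * x = 0

/-- A quaternion division `F`-algebra: a `4`-dimensional central `F`-algebra which is a
division ring. -/
def IsQuaternionDivisionAlgebra (F D : Type*) [Field F] [Ring D] [Algebra F D] : Prop :=
  (∀ x : D, x ≠ 0 → IsUnit x) ∧ Module.finrank F D = 4 ∧
    ∀ d : D, (∀ e : D, d * e = e * d) → ∃ c : F, algebraMap F D c = d

/-- `(A, σ)` is weakly hyperbolic: for some `n ≥ 1` the algebra with involution
`n × (A, σ) = (Mₙ(F), t) ⊗ (A, σ) ≅ (Mₙ(A), X ↦ σ(X)ᵀ)` is hyperbolic, i.e. contains an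
idempotent `e` with `σ(e) = 1 - e`. -/
def InvWeaklyHyperbolic {A : Type*} [Ring A] (σ : A → A) : Prop :=
  ∃ (n : ℕ) (e : Matrix (Fin (n + 1)) (Fin (n + 1)) A),
    e * e = e ∧ e.transpose.map σ = 1 - e

universe u

section Involution

variable {F A : Type*} [Field F] [Ring A] [Algebra F A] {σ : A →ₗ[F] A}

theorem IsInvolutionFirstKind.map_one (hσ : IsInvolutionFirstKind σ) : σ 1 = 1 := by
  have h := hσ.1 1 (σ 1)
  rw [one_mul, hσ.2, one_mul] at h
  exact h.symm

theorem IsInvolutionFirstKind.map_algebraMap (hσ : IsInvolutionFirstKind σ) (c : F) :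
    σ (algebraMap F A c) = algebraMap F A c := by
  rw [Algebra.algebraMap_eq_smul_one, map_smul, hσ.map_one]

/-- `a * b = ± (b * a)`. -/
def SignCommute (F : Type*) {A : Type*} [Field F] [Ring A] [Algebra F A] (a b : A) : Prop :=
  ∃ t : F, t * t = 1 ∧ a * b = t • (b * a)

theorem SignCommute.symm {a b : A} (h : SignCommute F a b) : SignCommute F b a := by
  obtain ⟨t, ht, h⟩ := h
  exact ⟨t, ht, by rw [h, smul_smul, ht, one_smul]⟩

theorem SignCommute.mul_right {a b c : A} (hb : SignCommute F a b) (hc : SignCommute F a c) :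
    SignCommute F a (b * c) := by
  obtain ⟨t, ht, hb⟩ := hb
  obtain ⟨u, hu, hc⟩ := hc
  refine ⟨t * u, by linear_combination u * u * ht + hu, ?_⟩
  rw [← mul_assoc, hb, smul_mul_assoc, mul_assoc, hc, mul_smul_comm, smul_smul, mul_assoc]

theorem SignCommute.mul_left {a b c : A} (ha : SignCommute F a c) (hb : SignCommute F b c) :
    SignCommute F (a * b) c :=
  (ha.symm.mul_right hb.symm).symm

theorem SignCommute.smul {a b : A} (h : SignCommute F a b) (x y : F) :
    SignCommute F (x • a) (y • b) := by
  obtain ⟨t, ht, h⟩ := h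
  refine ⟨t, ht, ?_⟩
  simp only [smul_mul_assoc, mul_smul_comm, h, smul_smul]
  congr 1
  ring

/-- `σ a = ± a` and `σ a * a = c`. -/
def IsSigned (σ : A →ₗ[F] A) (a : A) (c : F) : Prop :=
  (∃ s : F, s * s = 1 ∧ σ a = s • a) ∧ σ a * a = algebraMap F A c

theorem IsSigned.smul {a : A} {c : F} (h : IsSigned σ a c) (x : F) :
    IsSigned σ (x • a) (x * x * c) := by
  obtain ⟨⟨s, hs, h⟩, hc⟩ := h
  refine ⟨⟨s, hs, by rw [map_smul, h, smul_comm]⟩, ?_⟩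
  rw [map_smul, smul_mul_smul_comm, hc, map_mul, Algebra.smul_def]

theorem IsSigned.mul (hσ : IsInvolutionFirstKind σ) {a b : A} {c d : F} (ha : IsSigned σ a c)
    (hb : IsSigned σ b d) (hab : SignCommute F a b) : IsSigned σ (a * b) (c * d) := by
  obtain ⟨⟨s, hs, ha⟩, hc⟩ := ha
  obtain ⟨⟨t, ht, hb⟩, hd⟩ := hb
  obtain ⟨u, hu, hab⟩ := hab.symm
  refine ⟨⟨s * t * u, by linear_combination t * t * u * u * hs + u * u * ht + hu, ?_⟩, ?_⟩
  · rw [hσ.1, ha, hb, smul_mul_smul_comm, hab, smul_smul]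
    congr 1
    ring
  · rw [hσ.1, mul_assoc, ← mul_assoc (σ a), hc, Algebra.commutes, ← mul_assoc, hd, mul_comm c d,
      map_mul]

end Involution

section WeaklyHyperbolic

theorem exists_signed_matrices (F : Type*) [Field F] : ∀ (N : ℕ) (s : Fin N → F)
    (t : Fin N → Fin N → F), (∀ i, s i * s i = 1) → (∀ i j, t i j * t i j = 1) →
    ∃ (m : Type) (_ : Fintype m) (_ : DecidableEq m) (_ : Nonempty m)
      (S : Fin N → Matrix m m F), (∀ i, (S i).transpose = s i • S i) ∧
        (∀ i, (S i).transpose * S i = 1) ∧ ∀ i j, i < j → S i * S j = t i j • (S j * S i) := by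
  intro N
  induction N with
  | zero => exact fun s t _ _ => ⟨Unit, inferInstance, inferInstance, inferInstance,
      fun _ => 0, fun i => i.elim0, fun i => i.elim0, fun i => i.elim0⟩
  | succ N ih =>
    intro s t hs ht
    obtain ⟨m, _, _, _, S, h1, h2, h3⟩ := ih (fun i => s i.succ) (fun i j => t i.succ j.succ)
      (fun i => hs _) (fun i j => ht _ _)
    refine ⟨m ⊕ m, inferInstance, inferInstance, inferInstance,
      Fin.cons (Matrix.fromBlocks 0 (s 0 • 1) 1 0)
        (fun i => Matrix.fromBlocks (S i) 0 0 (t 0 i.succ • S i)), ?_, ?_, ?_⟩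
    · intro i
      cases i using Fin.cases with
      | zero => simp [Matrix.fromBlocks_transpose, Matrix.fromBlocks_smul, smul_smul, hs]
      | succ i =>
        simp [Matrix.fromBlocks_transpose, Matrix.fromBlocks_smul, h1, smul_comm (t 0 i.succ)]
    · intro i
      cases i using Fin.cases with
      | zero => simp [Matrix.fromBlocks_transpose, Matrix.fromBlocks_multiply, smul_smul, hs]
      | succ i => simp [Matrix.fromBlocks_transpose, Matrix.fromBlocks_multiply, smul_smul, h2, ht]
    · intro i j hij
      cases j using Fin.cases with
      | zero => simp at hij
      | succ j =>
        cases i using Fin.cases with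
        | zero =>
          simp [Matrix.fromBlocks_multiply, Matrix.fromBlocks_smul, smul_smul, ht, mul_comm]
        | succ i =>
          simp [Matrix.fromBlocks_multiply, Matrix.fromBlocks_smul, smul_smul,
            h3 i j (by simpa using hij)]
          congr 1
          ring

variable {F A : Type*} [Field F] [Ring A] [Algebra F A] {σ : A →ₗ[F] A}

theorem invWeaklyHyperbolic_of_sq_eq_one (h2 : (2 : F) ≠ 0) (hσ : IsInvolutionFirstKind σ)
    {m : Type*} [Fintype m] [DecidableEq m] [Nonempty m] (f : Matrix m m A) (hf : f * f = 1)
    (hfσ : f.transpose.map σ = -f) : InvWeaklyHyperbolic σ := by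
  obtain ⟨n, hn⟩ := Nat.exists_eq_succ_of_ne_zero (Fintype.card_ne_zero (α := m))
  let g : Fin (n + 1) ≃ m := (Fintype.equivFinOfCardEq hn).symm
  have hh : f.submatrix g g * f.submatrix g g = 1 := by
    rw [Matrix.submatrix_mul_equiv, hf, Matrix.submatrix_one_equiv]
  refine ⟨n, (2 : F)⁻¹ • (1 + f.submatrix g g), ?_, ?_⟩
  · rw [smul_mul_smul_comm, mul_add, mul_one, add_mul, one_mul, hh,
      show 1 + f.submatrix g g + (f.submatrix g g + 1) = (2 : F) • (1 + f.submatrix g g) by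
        rw [two_smul]; abel, smul_smul]
    congr 1
    field_simp
  · have key : ((2 : F)⁻¹ • (1 + f.submatrix g g)).transpose.map σ
        = (2 : F)⁻¹ • (1 - f.submatrix g g) := by
      ext i j
      have := congrFun (congrFun hfσ (g i)) (g j)
      simp only [Matrix.map_apply, Matrix.transpose_apply, Matrix.neg_apply] at this
      simp only [Matrix.map_apply, Matrix.transpose_apply, Matrix.smul_apply, Matrix.add_apply,
        Matrix.sub_apply, Matrix.submatrix_apply, map_smul, map_add, this, Matrix.one_apply,
        eq_comm (a := j)]
      split_ifs <;> simp [hσ.map_one, sub_eq_add_neg]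
    rw [key, eq_sub_iff_add_eq, ← smul_add, show 1 - f.submatrix g g + (1 + f.submatrix g g)
      = (2 : F) • 1 by rw [two_smul]; abel, smul_smul, inv_mul_cancel₀ h2, one_smul]

theorem map_smul_mul_map_smul {m : Type*} [Fintype m] (S T : Matrix m m F) (a b : A) :
    (S.map (· • a)) * (T.map (· • b)) = (S * T).map (· • (a * b)) := by
  ext i j
  simp only [Matrix.map_apply, Matrix.mul_apply, smul_mul_smul_comm, Finset.sum_smul]

theorem invWeaklyHyperbolic_of_sum_fin_eq_neg_one (h2 : (2 : F) ≠ 0)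
    (hσ : IsInvolutionFirstKind σ) {N : ℕ} (a : Fin N → A) (c : Fin N → F)
    (ha : ∀ i, IsSigned σ (a i) (c i)) (hcomm : ∀ i j, SignCommute F (a i) (a j)) (hsum : ∑ i, c i = -1) :
    InvWeaklyHyperbolic σ := by
  choose s hs hsa using fun i => (ha i).1
  choose t ht hta using hcomm
  obtain ⟨m, _, _, _, S, hS1, hS2, hS3⟩ := exists_signed_matrices F N (fun i => -s i)
    (fun i j => -t i j) (by simpa using hs) (by simpa using ht)
  let f : Fin N → Matrix m m A := fun i => (S i).map (· • a i)
  have hlt : ∀ i j, i < j → f i * f j + f j * f i = 0 := by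
    intro i j hij
    simp only [f, map_smul_mul_map_smul, hS3 i j hij, hta i j]
    ext k l
    simp [smul_smul, mul_comm (t i j), mul_assoc, ht]
  have hsq : ∀ i, f i * f i = -(c i) • 1 := by
    intro i
    have e1 : S i * S i = -s i • 1 := by
      rw [← hS2 i, hS1 i, smul_mul_assoc, smul_smul, neg_mul_neg, hs, one_smul]
    have e2 : a i * a i = s i • algebraMap F A (c i) := by
      rw [← (ha i).2, hsa i, smul_mul_assoc, smul_smul, hs, one_smul]
    simp only [f, map_smul_mul_map_smul, e1, e2]
    ext k l
    by_cases hkl : k = l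
    · simp [hkl, smul_smul, ← mul_assoc, hs, Algebra.algebraMap_eq_smul_one]
    · simp [hkl]
  refine invWeaklyHyperbolic_of_sq_eq_one h2 hσ (∑ i, f i) ?_ ?_
  · have h : (2 : F) • ((∑ i, f i) * ∑ i, f i) = (2 : F) • 1 := by
      have e1 : (∑ i, f i) * ∑ i, f i = ∑ i, ∑ j, f i * f j := Finset.sum_mul_sum _ _ _ _
      have e2 : (∑ i, f i) * ∑ i, f i = ∑ i, ∑ j, f j * f i := by rw [e1, Finset.sum_comm]
      rw [two_smul]
      nth_rewrite 1 [e2]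
      rw [e1, ← Finset.sum_add_distrib]
      simp_rw [← Finset.sum_add_distrib]
      have : ∀ i j, f j * f i + f i * f j = if i = j then (2 : F) • (-(c i) • 1) else 0 := by
        intro i j
        rcases lt_trichotomy i j with h | rfl | h
        · rw [if_neg h.ne, add_comm, hlt i j h]
        · rw [if_pos rfl, hsq, two_smul]
        · rw [if_neg h.ne', hlt j i h]
      simp_rw [this]
      simp only [Finset.sum_ite_eq, Finset.mem_univ, if_true]
      rw [← Finset.smul_sum, ← Finset.sum_smul, Finset.sum_neg_distrib, hsum, neg_neg, one_smul]
    exact smul_right_injective _ h2 h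
  · ext k l
    simp only [Matrix.map_apply, Matrix.transpose_apply, Matrix.neg_apply, Matrix.sum_apply,
      map_sum, ← Finset.sum_neg_distrib]
    refine Finset.sum_congr rfl fun i _ => ?_
    have e := congrFun (congrFun (hS1 i) k) l
    simp only [Matrix.transpose_apply, Matrix.smul_apply, smul_eq_mul] at e
    simp only [f, Matrix.map_apply, map_smul, hsa, e, smul_smul, ← neg_smul]
    congr 1
    linear_combination -(S i k l) * hs i

theorem invWeaklyHyperbolic_of_sum_eq_neg_one (h2 : (2 : F) ≠ 0) (hσ : IsInvolutionFirstKind σ)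
    {κ : Type*} [Fintype κ] (a : κ → A) (c : κ → F) (ha : ∀ i, IsSigned σ (a i) (c i))
    (hcomm : ∀ i j, SignCommute F (a i) (a j)) (hsum : ∑ i, c i = -1) :
    InvWeaklyHyperbolic σ := by
  let g := (Fintype.equivFin κ).symm
  refine invWeaklyHyperbolic_of_sum_fin_eq_neg_one h2 hσ (fun i => a (g i)) (fun i => c (g i))
    (fun i => ha _) (fun i j => hcomm _ _) ?_
  rw [← hsum]
  exact Equiv.sum_comp g c

theorem invWeaklyHyperbolic_of_invWeaklyIsotropic (h2 : (2 : F) ≠ 0)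
    (hσ : IsInvolutionFirstKind σ) {ι : Type*} [Fintype ι] (g : Module.Basis ι F A) (T : A →ₗ[F] F)
    (c : ι → F) (hc : ∀ i, c i ≠ 0) [DecidableEq ι]
    (hT : ∀ i j, T (σ (g i) * g j) = if i = j then c i else 0)
    (a : ι → A) (ha : ∀ i, IsSigned σ (a i) (c i)) (hcomm : ∀ i j, SignCommute F (a i) (a j))
    (h : InvWeaklyIsotropic σ) : InvWeaklyHyperbolic σ := by
  obtain ⟨n, x, hx, hsum⟩ := h
  have hTx : ∀ y : A, T (σ y * y) = ∑ i, g.repr y i * g.repr y i * c i := by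
    intro y
    conv_lhs => rw [← g.sum_repr y]
    simp only [map_sum, map_smul, Finset.sum_mul, Finset.mul_sum, smul_mul_smul_comm, hT]
    simp
  obtain ⟨j, hj⟩ : ∃ j, g.repr (x 0) j ≠ 0 := by
    by_contra! hne
    exact hx 0 (g.repr.map_eq_zero_iff.1 (Finsupp.ext hne))
  let y : Fin (n + 1) × ι → F := fun p => g.repr (x p.1) p.2
  have hy : ∑ p, y p * y p * c p.2 = 0 := by
    rw [Fintype.sum_prod_type]
    simp only [y, ← hTx]
    rw [← map_sum, hsum, map_zero]
  let z : F := (y (0, j) * c j)⁻¹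
  classical
  refine invWeaklyHyperbolic_of_sum_eq_neg_one h2 hσ
    (fun p : {p : Fin (n + 1) × ι // p ≠ (0, j)} => (y p * z) • (a p.1.2 * a j))
    (fun p => (y p * z) * (y p * z) * (c p.1.2 * c j))
    (fun p => ((ha _).mul hσ (ha _) (hcomm _ _)).smul _)
    (fun p q => (((hcomm _ _).mul_left (hcomm _ _)).mul_right
      ((hcomm _ _).mul_left (hcomm _ _))).smul _ _) ?_
  have e := Fintype.sum_subtype_add_sum_subtype (fun p : Fin (n + 1) × ι => p ≠ (0, j))
    (fun p => (y p * z) * (y p * z) * (c p.2 * c j))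
  have e1 : ∑ p : Fin (n + 1) × ι, (y p * z) * (y p * z) * (c p.2 * c j) = 0 := by
    have : ∀ p : Fin (n + 1) × ι, (y p * z) * (y p * z) * (c p.2 * c j)
        = (z * z * c j) * (y p * y p * c p.2) := fun p => by ring
    simp_rw [this]
    rw [← Finset.mul_sum, hy, mul_zero]
  have e2 : ∑ p : {p : Fin (n + 1) × ι // ¬ p ≠ (0, j)},
      (y p * z) * (y p * z) * (c p.1.2 * c j) = 1 := by
    have : Unique {p : Fin (n + 1) × ι // ¬ p ≠ (0, j)} :=
      ⟨⟨⟨(0, j), by simp⟩⟩, fun p => Subtype.ext (not_not.1 p.2)⟩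
    rw [Fintype.sum_unique]
    have hd : ((default : {p : Fin (n + 1) × ι // ¬ p ≠ (0, j)}) : Fin (n + 1) × ι) = (0, j) :=
      not_not.1 (default : {p : Fin (n + 1) × ι // ¬ p ≠ (0, j)}).2
    rw [hd]
    have := hc j
    have : y (0, j) ≠ 0 := hj
    simp only [z]
    field_simp
  rw [e1, e2] at e
  exact eq_neg_of_add_eq_zero_left e

theorem InvWeaklyHyperbolic.invWeaklyIsotropic [Nontrivial A] (h : InvWeaklyHyperbolic σ) :
    InvWeaklyIsotropic σ := by
  obtain ⟨n, e, he, hσe⟩ := h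
  have h0 : e.transpose.map σ * e = 0 := by rw [hσe, sub_mul, one_mul, he, sub_self]
  obtain ⟨k, j, hkj⟩ : ∃ k j, e k j ≠ 0 := by
    by_contra! hne
    obtain rfl : e = 0 := Matrix.ext hne
    have := congrFun (congrFun hσe 0) 0
    simp at this
  classical
  let p : Fin (n + 1) → Prop := fun i => e i j ≠ 0
  have hcard : 0 < Fintype.card {i // p i} := Fintype.card_pos_iff.2 ⟨⟨k, hkj⟩⟩
  obtain ⟨N, hN⟩ := Nat.exists_eq_succ_of_ne_zero hcard.ne'
  let g := (Fintype.equivFinOfCardEq hN).symm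
  refine ⟨N, fun i => e (g i) j, fun i => (g i).2, ?_⟩
  rw [Equiv.sum_comp g (fun i => σ (e i j) * e i j)]
  have hs := congrFun (congrFun h0 j) j
  rw [Matrix.mul_apply] at hs
  simp only [Matrix.map_apply, Matrix.transpose_apply, Matrix.zero_apply] at hs
  rw [← Fintype.sum_subtype_add_sum_subtype p] at hs
  rwa [Finset.sum_eq_zero (s := (Finset.univ : Finset {i // ¬ p i})), add_zero] at hs
  intro i _
  rw [not_not.1 i.2, mul_zero]

end WeaklyHyperbolic

section Quaternion

variable {F Q : Type*} [Field F] [Ring Q] [Algebra F Q]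

namespace IsQuaternionDivisionAlgebra

theorem mul_eq_zero (hQ : IsQuaternionDivisionAlgebra F Q) {x y : Q} (h : x * y = 0) :
    x = 0 ∨ y = 0 := by
  by_contra! hne
  exact hne.2 ((hQ.1 x hne.1).mul_right_eq_zero.1 h)

theorem commute_of_mul_add (hQ : IsQuaternionDivisionAlgebra F Q) {x y p q : Q}
    (hp : Commute x p) (hq : Commute x q) (hq0 : q ≠ 0) (h : p + y * q = 0) : Commute x y := by
  have hyq : y * q = -p := eq_neg_of_add_eq_zero_right h
  have e : (x * y - y * x) * q = 0 := by
    rw [sub_mul, mul_assoc, mul_assoc, hyq, hq.eq, ← mul_assoc, hyq, mul_neg, neg_mul, hp.eq,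
      sub_self]
  exact sub_eq_zero.1 ((hQ.mul_eq_zero e).resolve_right hq0)

theorem exists_sq_eq (hQ : IsQuaternionDivisionAlgebra F Q) (x : Q) :
    ∃ a b : F, x * x = a • x + algebraMap F Q b := by
  by_contra! hx
  have hx' : ∀ c, algebraMap F Q c ≠ x := by
    rintro c rfl
    exact hx 0 (c * c) (by simp)
  have hcomm : ∀ y, Commute x y := by
    intro y
    have hdep : ¬ LinearIndependent F ![1, x, x * x, y, y * x] := by
      intro hli
      have : Module.Finite F Q := Module.finite_of_finrank_pos (by rw [hQ.2.1]; norm_num)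
      have := hli.fintype_card_le_finrank
      rw [hQ.2.1] at this
      simp at this
    obtain ⟨g, hg, hne⟩ := Fintype.not_linearIndependent_iff.1 hdep
    simp only [Fin.sum_univ_five, Matrix.cons_val] at hg
    by_cases hq : algebraMap F Q (g 3) + g 4 • x = 0
    · exfalso
      have h4 : g 4 = 0 := by
        by_contra h4
        refine hx' (-((g 4)⁻¹ * g 3)) ?_
        have := congrArg ((g 4)⁻¹ • ·) hq
        simp only [smul_add, smul_smul, inv_mul_cancel₀ h4, one_smul, smul_zero] at this
        rw [map_neg, map_mul, ← Algebra.smul_def]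
        exact neg_eq_of_add_eq_zero_right this
      have h3 : g 3 = 0 := by
        have hN : Nontrivial Q := ⟨⟨x, 0, fun h => hx' 0 (by rw [h, map_zero])⟩⟩
        simpa [h4] using hq
      rw [h3, h4, zero_smul, zero_smul, add_zero, add_zero] at hg
      by_cases h2 : g 2 = 0
      · rw [h2, zero_smul, add_zero] at hg
        by_cases h1 : g 1 = 0
        · have hN : Nontrivial Q := ⟨⟨x, 0, fun h => hx' 0 (by rw [h, map_zero])⟩⟩
          rw [h1, zero_smul, add_zero] at hg
          have h0 : g 0 = 0 := by simpa using hg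
          obtain ⟨i, hi⟩ := hne
          fin_cases i <;> simp_all
        · refine hx' (-((g 1)⁻¹ * g 0)) ?_
          have := congrArg ((g 1)⁻¹ • ·) hg
          simp only [smul_add, smul_smul, inv_mul_cancel₀ h1, one_smul, smul_zero] at this
          rw [map_neg, Algebra.algebraMap_eq_smul_one]
          exact neg_eq_of_add_eq_zero_right this
      · refine hx (-((g 2)⁻¹ * g 1)) (-((g 2)⁻¹ * g 0)) ?_
        have := congrArg ((g 2)⁻¹ • ·) hg
        simp only [smul_add, smul_smul, inv_mul_cancel₀ h2, one_smul, smul_zero] at this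
        rw [map_neg, Algebra.algebraMap_eq_smul_one, neg_smul, ← neg_add, add_comm]
        exact (neg_eq_of_add_eq_zero_right this).symm
    · refine hQ.commute_of_mul_add (p := g 0 • 1 + g 1 • x + g 2 • (x * x)) ?_ ?_ hq ?_
      · exact (((Commute.one_right x).smul_right _).add_right
          ((Commute.refl x).smul_right _)).add_right
          (((Commute.refl x).mul_right (Commute.refl x)).smul_right _)
      · exact (Algebra.commute_algebraMap_right (g 3) x).add_right ((Commute.refl x).smul_right _)
      · rw [mul_add, mul_smul_comm, ← Algebra.commutes, ← Algebra.smul_def, ← add_assoc]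
        exact hg
  obtain ⟨c, hc⟩ := hQ.2.2 x hcomm
  exact hx' c hc

theorem sq_eq_of_map_neg (hQ : IsQuaternionDivisionAlgebra F Q) (h2 : (2 : F) ≠ 0) {x : Q}
    (hx0 : x ≠ 0) (θ : Q →ₗ[F] Q) (hθ : θ x = -x) (hθ2 : θ (x * x) = x * x)
    (hθF : ∀ c, θ (algebraMap F Q c) = algebraMap F Q c) :
    ∃ c : F, c ≠ 0 ∧ x * x = algebraMap F Q c := by
  obtain ⟨a, b, hab⟩ := hQ.exists_sq_eq x
  have e := hθ2
  rw [hab, map_add, map_smul, hθ, hθF, add_left_inj, smul_neg, neg_eq_iff_add_eq_zero, ← two_smul F,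
    smul_smul] at e
  have ha : a = 0 := by
    simpa [hx0, h2] using (smul_eq_zero.1 e)
  rw [ha, zero_smul, zero_add] at hab
  refine ⟨b, ?_, hab⟩
  rintro rfl
  rw [map_zero] at hab
  simpa [hx0] using hQ.mul_eq_zero hab

theorem exists_anticommuting (hQ : IsQuaternionDivisionAlgebra F Q) (h2 : (2 : F) ≠ 0)
    (σ : Q →ₗ[F] Q) (hσ : IsInvolutionFirstKind σ) :
    ∃ (u v : Q) (a b s : F), a ≠ 0 ∧ b ≠ 0 ∧ u * u = algebraMap F Q a ∧
      v * v = algebraMap F Q b ∧ v * u = -(u * v) ∧ σ u = -u ∧ s * s = 1 ∧ σ v = s • v := by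
  have hN : Nontrivial Q := by
    apply Module.nontrivial_of_finrank_pos (R := F)
    rw [hQ.2.1]
    norm_num
  obtain ⟨u, hu0, hu⟩ : ∃ u : Q, u ≠ 0 ∧ σ u = -u := by
    by_contra! hne
    have hid : ∀ x, σ x = x := by
      intro x
      by_contra hx
      refine hne (x - σ x) (sub_ne_zero.2 (Ne.symm hx)) ?_
      rw [map_sub, hσ.2, neg_sub]
    have hcomm : ∀ x y : Q, x * y = y * x := by
      intro x y
      have := hσ.1 x y
      rwa [hid, hid, hid] at this
    have := finrank_le_one (R := F) (1 : Q) fun w => by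
      obtain ⟨c, hc⟩ := hQ.2.2 w (hcomm w)
      exact ⟨c, by rw [← hc, Algebra.algebraMap_eq_smul_one]⟩
    rw [hQ.2.1] at this
    norm_num at this
  obtain ⟨a, ha0, ha⟩ := hQ.sq_eq_of_map_neg h2 hu0 σ hu (by rw [hσ.1, hu, neg_mul_neg])
    hσ.map_algebraMap
  have hadd : ∀ x : Q, x + x = 0 → x = 0 := by
    intro x hx
    rw [← two_smul F, smul_eq_zero] at hx
    exact hx.resolve_left h2
  obtain ⟨w, hw⟩ : ∃ w, u * w ≠ w * u := by
    by_contra! hc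
    obtain ⟨c, rfl⟩ := hQ.2.2 u hc
    rw [hσ.map_algebraMap] at hu
    exact hu0 (hadd _ (by nth_rewrite 1 [hu]; simp))
  have hw'0 : u * w - w * u ≠ 0 := sub_ne_zero.2 hw
  have hw'u : (u * w - w * u) * u = -(u * (u * w - w * u)) := by
    have e : u * (u * w) = w * u * u := by
      rw [← mul_assoc, ha, mul_assoc, ha, Algebra.commutes]
    rw [sub_mul, mul_sub, e]
    simp [mul_assoc]
  generalize u * w - w * u = w' at hw'0 hw'u
  have hσw' : σ w' * u = -(u * σ w') := by
    have := congrArg σ hw'u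
    rw [map_neg, hσ.1, hσ.1, hu, neg_mul, mul_neg, neg_neg] at this
    exact this.symm
  obtain ⟨v, s, hv0, hvu, hs, hv⟩ : ∃ (v : Q) (s : F), v ≠ 0 ∧ v * u = -(u * v) ∧ s * s = 1 ∧
      σ v = s • v := by
    by_cases h : w' + σ w' = 0
    · exact ⟨w', -1, hw'0, hw'u, by simp, by simpa using eq_neg_of_add_eq_zero_right h⟩
    · exact ⟨w' + σ w', 1, h, by rw [add_mul, hw'u, hσw', mul_add, neg_add], by simp,
        by rw [map_add, hσ.2, one_smul, add_comm]⟩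
  let θ : Q →ₗ[F] Q := a⁻¹ • (LinearMap.mulLeft F u ∘ₗ LinearMap.mulRight F u)
  have hθ : ∀ x, θ x = a⁻¹ • (u * (x * u)) := fun x => rfl
  obtain ⟨b, hb0, hb⟩ := hQ.sq_eq_of_map_neg h2 hv0 θ
    (by rw [hθ, hvu, mul_neg, ← mul_assoc, ha, ← Algebra.smul_def, smul_neg, smul_smul,
      inv_mul_cancel₀ ha0, one_smul])
    (by rw [hθ, mul_assoc, hvu, mul_neg, ← mul_assoc v, hvu, neg_mul, neg_neg, mul_assoc u,
      ← mul_assoc u u, ha, ← Algebra.smul_def, smul_smul, inv_mul_cancel₀ ha0, one_smul])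
    (fun c => by rw [hθ, Algebra.commutes, ← mul_assoc, ha, ← Algebra.smul_def, smul_smul,
      inv_mul_cancel₀ ha0, one_smul])
  exact ⟨u, v, a, b, s, ha0, hb0, ha, hb, hvu, hu, hs, hv⟩

theorem exists_normalized_trace (hQ : IsQuaternionDivisionAlgebra F Q) (h2 : (2 : F) ≠ 0) :
    ∃ T : Q →ₗ[F] F, (∀ x y, T (x * y) = T (y * x)) ∧ ∀ c, T (algebraMap F Q c) = c := by
  have h4 : (4 : F) ≠ 0 := by
    rw [show (4 : F) = 2 * 2 by norm_num]
    exact mul_ne_zero h2 h2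
  refine ⟨(4 : F)⁻¹ • (LinearMap.trace F Q ∘ₗ (Algebra.lmul F Q).toLinearMap),
    fun x y => ?_, fun c => ?_⟩
  · simp only [LinearMap.smul_apply, LinearMap.comp_apply, AlgHom.toLinearMap_apply, map_mul]
    rw [LinearMap.trace_mul_comm]
  · have : (Algebra.lmul F Q) (algebraMap F Q c) = c • LinearMap.id :=
      LinearMap.ext fun x => by simp [Algebra.smul_def]
    simp only [LinearMap.smul_apply, LinearMap.comp_apply, AlgHom.toLinearMap_apply, this]
    have : Module.Finite F Q := Module.finite_of_finrank_pos (by rw [hQ.2.1]; norm_num)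
    rw [map_smul, LinearMap.trace_id, hQ.2.1]
    simp only [smul_eq_mul]
    push_cast
    field_simp

theorem exists_signed_basis (hQ : IsQuaternionDivisionAlgebra F Q) (h2 : (2 : F) ≠ 0)
    (σ : Q →ₗ[F] Q) (hσ : IsInvolutionFirstKind σ) :
    ∃ (b : Module.Basis (Fin 4) F Q) (c : Fin 4 → F) (T : Q →ₗ[F] F), (∀ i, c i ≠ 0) ∧
      (∀ i, IsSigned σ (b i) (c i)) ∧ (∀ i j, SignCommute F (b i) (b j)) ∧
      ∀ i j, T (σ (b i) * b j) = if i = j then c i else 0 := by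
  obtain ⟨u, v, α, β, s, hα, hβ, hu, hv, hvu, hσu, hs, hσv⟩ := hQ.exists_anticommuting h2 σ hσ
  have hs0 : s ≠ 0 := by rintro rfl; simp at hs
  have huw : u * v * u = -(u * (u * v)) := by rw [mul_assoc, hvu, mul_neg]
  have hvw : u * v * v = -(v * (u * v)) := by rw [← mul_assoc, hvu, neg_mul, neg_neg]
  have huS : IsSigned σ u (-α) := ⟨⟨-1, by simp, by simp [hσu]⟩, by simp [hσu, hu]⟩
  have hvS : IsSigned σ v (s * β) := ⟨⟨s, hs, hσv⟩, by
    rw [hσv, smul_mul_assoc, hv, map_mul, Algebra.smul_def]⟩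
  have anti {x y : Q} (h : y * x = -(x * y)) : SignCommute F x y :=
    ⟨-1, by simp, by simp [h]⟩
  have comm {x y : Q} (h : x * y = y * x) : SignCommute F x y := ⟨1, by simp, by simp [h]⟩
  obtain ⟨T, hTmul, hT1⟩ := hQ.exists_normalized_trace h2
  have hTanti {x y : Q} (h : y * x = -(x * y)) : T (x * y) = 0 := by
    have e : T (x * y) = -T (x * y) := by
      conv_lhs => rw [hTmul, h, map_neg]
    have e' : 2 * T (x * y) = 0 := by linear_combination e
    simpa [h2] using e'
  have hT0 {g w : Q} {c : F} (hc : c ≠ 0) (hg : g * g = algebraMap F Q c)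
      (hgw : g * w = -(w * g)) : T w = 0 := by
    have e : T (g * (g * w)) = 0 := by
      refine hTanti ?_
      nth_rewrite 2 [hgw]
      rw [mul_neg, neg_neg, mul_assoc]
    rw [← mul_assoc, hg, ← Algebra.smul_def, map_smul] at e
    simpa [hc] using e
  let b : Fin 4 → Q := ![1, u, v, u * v]
  let c : Fin 4 → F := ![1, -α, s * β, -α * (s * β)]
  have hc : ∀ i, c i ≠ 0 := by
    intro i
    fin_cases i <;> simp [c, hα, hβ, hs0]
  have hb : ∀ i, IsSigned σ (b i) (c i) := by
    intro i
    fin_cases i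
    · exact ⟨⟨1, by simp, by simp [b, hσ.map_one]⟩, by simp [b, c, hσ.map_one]⟩
    · exact huS
    · exact hvS
    · exact huS.mul hσ hvS (anti hvu)
  have hcomm : ∀ i j, SignCommute F (b i) (b j) := by
    intro i j
    fin_cases i <;> fin_cases j
    · exact comm rfl
    · exact comm (by simp [b])
    · exact comm (by simp [b])
    · exact comm (by simp [b])
    · exact comm (by simp [b])
    · exact comm rfl
    · exact anti hvu
    · exact anti huw
    · exact comm (by simp [b])
    · exact (anti hvu).symm
    · exact comm rfl
    · exact anti hvw
    · exact comm (by simp [b])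
    · exact (anti huw).symm
    · exact (anti hvw).symm
    · exact comm rfl
  have hT' : ∀ i j, i ≠ j → T (b i * b j) = 0 := by
    have hTu : T u = 0 := hT0 hβ hv hvu
    have hTv : T v = 0 := hT0 hα hu (by rw [hvu, neg_neg])
    have hTw : T (u * v) = 0 := hT0 hα hu (by rw [huw, neg_neg])
    intro i j hij
    fin_cases i <;> fin_cases j
    · exact absurd rfl hij
    · simpa [b] using hTu
    · simpa [b] using hTv
    · simpa [b] using hTw
    · simpa [b] using hTu
    · exact absurd rfl hij
    · exact hTanti hvu
    · exact hTanti huw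
    · simpa [b] using hTv
    · exact hTanti (by simp [b, hvu])
    · exact absurd rfl hij
    · exact hTanti hvw
    · simpa [b] using hTw
    · exact hTanti (by simp [b, huw])
    · exact hTanti (by simp [b, hvw])
    · exact absurd rfl hij
  have hT : ∀ i j, T (σ (b i) * b j) = if i = j then c i else 0 := by
    intro i j
    split_ifs with hij
    · subst hij
      rw [(hb i).2, hT1]
    · obtain ⟨t, -, ht⟩ := (hb i).1
      rw [ht, smul_mul_assoc, map_smul, hT' i j hij, smul_zero]
  have hli : LinearIndependent F b := by
    rw [Fintype.linearIndependent_iff]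
    intro g hg i
    have := congrArg (fun x => T (σ (b i) * x)) hg
    simpa [Finset.mul_sum, hT, hc] using this
  let B := basisOfLinearIndependentOfCardEqFinrank hli (by rw [hQ.2.1]; simp)
  have hB : ⇑B = b := coe_basisOfLinearIndependentOfCardEqFinrank hli _
  exact ⟨B, c, T, hc, by rwa [hB], by rwa [hB], by rwa [hB]⟩

end IsQuaternionDivisionAlgebra

end Quaternion

section Decomposable

variable {F : Type*} [Field F]

theorem IsFormallyRealField.two_ne_zero (hF : IsFormallyRealField F) : (2 : F) ≠ 0 := by
  intro h
  refine hF 1 (fun _ => 1) ?_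
  simp only [one_pow, Fin.sum_univ_one]
  linear_combination h

variable {ι : Type*} [Fintype ι] {Q : ι → Type*} [∀ i, Ring (Q i)] [∀ i, Algebra F (Q i)]

theorem exists_tprod_eq_smul_tprod {x y : ∀ i, Q i}
    (h : ∀ i, ∃ t : F, t * t = 1 ∧ x i = t • y i) :
    ∃ t : F, t * t = 1 ∧ PiTensorProduct.tprod F x = t • PiTensorProduct.tprod F y := by
  choose t ht hxy using h
  refine ⟨∏ i, t i, by rw [← Finset.prod_mul_distrib, Finset.prod_eq_one fun i _ => ht i], ?_⟩
  rw [← MultilinearMap.map_smul_univ]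
  exact congrArg _ (funext hxy)

theorem tprod_algebraMap (c : ι → F) :
    PiTensorProduct.tprod F (fun i => algebraMap F (Q i) (c i)) =
      algebraMap F (⨂[F] i, Q i) (∏ i, c i) := by
  simp only [Algebra.algebraMap_eq_smul_one]
  rw [MultilinearMap.map_smul_univ]
  rfl

theorem invWeaklyHyperbolic_of_decomposable (h2 : (2 : F) ≠ 0) {A : Type*} [Ring A] [Algebra F A]
    (σ : A →ₗ[F] A) (hσ : IsInvolutionFirstKind σ) {n : Type*} [Fintype n] [DecidableEq n]
    (σQ : ∀ i, Q i →ₗ[F] Q i) (hQ : ∀ i, IsQuaternionDivisionAlgebra F (Q i))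
    (hσQ : ∀ i, IsInvolutionFirstKind (σQ i))
    (e : A ≃ₐ[F] ((⨂[F] i, Q i) ⊗[F] Matrix n n F))
    (he : ∀ (q : ∀ i, Q i) (M : Matrix n n F),
      e (σ (e.symm ((PiTensorProduct.tprod F q) ⊗ₜ[F] M))) =
        (PiTensorProduct.tprod F fun i => σQ i (q i)) ⊗ₜ[F] M.transpose)
    (h : InvWeaklyIsotropic σ) : InvWeaklyHyperbolic σ := by
  classical
  choose b c T hc hb hcomm hT using
    fun i => (hQ i).exists_signed_basis h2 (σQ i) (hσQ i)
  have hσe : ∀ (q : ∀ i, Q i) (M : Matrix n n F),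
      σ (e.symm ((PiTensorProduct.tprod F q) ⊗ₜ[F] M)) =
        e.symm ((PiTensorProduct.tprod F fun i => σQ i (q i)) ⊗ₜ[F] M.transpose) :=
    fun q M => e.injective (by rw [he, e.apply_symm_apply])
  let g : Module.Basis ((ι → Fin 4) × (n × n)) F A :=
    ((Basis.piTensorProduct b).tensorProduct (Matrix.stdBasis F n n)).map e.symm.toLinearEquiv
  have hg : ∀ p, g p = e.symm ((PiTensorProduct.tprod F fun i => b i (p.1 i)) ⊗ₜ[F]
      Matrix.single p.2.1 p.2.2 1) := by
    rintro ⟨p, k, l⟩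
    simp [g, Module.Basis.tensorProduct_apply, Matrix.stdBasis_eq_single]
  let τ : A →ₗ[F] F := LinearMap.mul' F F ∘ₗ TensorProduct.map
    (PiTensorProduct.lift ((MultilinearMap.mkPiAlgebra F ι F).compLinearMap T))
    (Matrix.traceLinearMap n F F) ∘ₗ e.toLinearMap
  have hτ : ∀ q M, τ (e.symm ((PiTensorProduct.tprod F q) ⊗ₜ[F] M)) =
      (∏ i, T i (q i)) * M.trace := by
    intro q M
    simp [τ]
  refine invWeaklyHyperbolic_of_invWeaklyIsotropic h2 hσ g τ (fun p => ∏ i, c i (p.1 i))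
    (fun p => Finset.prod_ne_zero_iff.2 fun i _ => hc i _) ?_
    (fun p => e.symm ((PiTensorProduct.tprod F fun i => b i (p.1 i)) ⊗ₜ[F] 1)) ?_ ?_ h
  · rintro ⟨p, k, l⟩ ⟨p', k', l'⟩
    rw [hg, hg, hσe, ← map_mul, Algebra.TensorProduct.tmul_mul_tmul,
      PiTensorProduct.tprod_mul_tprod, hτ]
    simp only [Pi.mul_apply, hT, Matrix.transpose_single]
    by_cases hp : p = p'
    · subst hp
      by_cases hk : k = k'
      · subst hk
        by_cases hl : l = l'
        · subst hl
          simp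
        · simp [hl, Matrix.trace_single_eq_of_ne, Prod.ext_iff]
      · simp [hk, Prod.ext_iff]
    · obtain ⟨i, hi⟩ := Function.ne_iff.1 hp
      rw [Finset.prod_eq_zero (Finset.mem_univ i) (if_neg hi), zero_mul, if_neg]
      exact fun h => hp (congrArg Prod.fst h)
  · intro p
    refine ⟨?_, ?_⟩
    · obtain ⟨t, ht, h⟩ := exists_tprod_eq_smul_tprod fun i => (hb i (p.1 i)).1
      exact ⟨t, ht, by rw [hσe, h, Matrix.transpose_one, ← TensorProduct.smul_tmul', map_smul]⟩
    · rw [hσe, ← map_mul, Algebra.TensorProduct.tmul_mul_tmul, PiTensorProduct.tprod_mul_tprod,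
        Matrix.transpose_one, one_mul, ← e.symm.commutes, Algebra.TensorProduct.algebraMap_apply,
        ← tprod_algebraMap]
      exact congrArg (fun x => e.symm (PiTensorProduct.tprod F x ⊗ₜ[F] 1))
        (funext fun i => (hb i (p.1 i)).2)
  · intro p q
    obtain ⟨t, ht, h⟩ := exists_tprod_eq_smul_tprod fun i => hcomm i (p.1 i) (q.1 i)
    refine ⟨t, ht, ?_⟩
    rw [← map_mul, ← map_mul, Algebra.TensorProduct.tmul_mul_tmul,
      Algebra.TensorProduct.tmul_mul_tmul, PiTensorProduct.tprod_mul_tprod,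
      PiTensorProduct.tprod_mul_tprod, ← map_smul, TensorProduct.smul_tmul']
    exact congrArg (fun x => e.symm (x ⊗ₜ[F] _)) h

end Decomposable

theorem weaklyIsotropic_iff_weaklyHyperbolic_of_decomposable
    {F : Type u} [Field F] (hF : IsFormallyRealField F)
    {A : Type u} [Ring A] [Algebra F A] [FiniteDimensional F A]
    [Algebra.IsCentral F A] [IsSimpleRing A]
    (σ : A →ₗ[F] A) (hσ : IsInvolutionFirstKind σ)
    (hdecomp : ∃ (r s : ℕ) (Q : Fin r → Type u) (_ : ∀ i, Ring (Q i))
        (_ : ∀ i, Algebra F (Q i)) (σQ : ∀ i, Q i →ₗ[F] Q i),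
        (∀ i, IsQuaternionDivisionAlgebra F (Q i)) ∧
        (∀ i, IsInvolutionFirstKind (σQ i)) ∧
        ∃ e : A ≃ₐ[F] ((⨂[F] i, Q i) ⊗[F] Matrix (Fin (s + 1)) (Fin (s + 1)) F),
          ∀ (q : ∀ i, Q i) (M : Matrix (Fin (s + 1)) (Fin (s + 1)) F),
            e (σ (e.symm ((PiTensorProduct.tprod F q) ⊗ₜ[F] M))) =
              (PiTensorProduct.tprod F fun i => σQ i (q i)) ⊗ₜ[F] M.transpose) :
    InvWeaklyIsotropic ⇑σ ↔ InvWeaklyHyperbolic ⇑σ := by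
  obtain ⟨r, s, Q, _, _, σQ, hQ, hσQ, e, he⟩ := hdecomp
  exact ⟨invWeaklyHyperbolic_of_decomposable hF.two_ne_zero σ hσ σQ hQ hσQ e he,
    InvWeaklyHyperbolic.invWeaklyIsotropic⟩
end

section
/- Let F be a formally real field, let a, b ∈ F^×, and let D = (a,b)_F be a quaternion division algebra. Suppose K is a field extension of F that splits D, i.e., D ⊗_F K ≅ M₂(K). Then for every ordering P of K one has a ∈ P or b ∈ P; consequently, for the restricted ordering P' = P ∩ F of F, the norm form ⟨1,−a,−b,ab⟩ of D is not definite at P', it is isotropic over every real closure F_{P'} of F at P', and D ⊗_F F_{P'} is split. -/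
open scoped TensorProduct

open Quaternion

universe u

namespace IsFieldOrdering

variable {K : Type*} [Field K] {P : Set K}

theorem add_mem (hP : IsFieldOrdering P) {x y : K} (hx : x ∈ P) (hy : y ∈ P) : x + y ∈ P :=
  hP.1 x hx y hy

theorem mul_mem (hP : IsFieldOrdering P) {x y : K} (hx : x ∈ P) (hy : y ∈ P) : x * y ∈ P :=
  hP.2.1 x hx y hy

theorem mem_or_neg_mem (hP : IsFieldOrdering P) (x : K) : x ∈ P ∨ -x ∈ P :=
  hP.2.2.1 x

theorem eq_zero_of_mem_of_neg_mem (hP : IsFieldOrdering P) {x : K} (hx : x ∈ P) (hx' : -x ∈ P) :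
    x = 0 :=
  hP.2.2.2 x hx hx'

theorem sq_mem (hP : IsFieldOrdering P) (x : K) : x ^ 2 ∈ P := by
  rcases hP.mem_or_neg_mem x with h | h
  · simpa [sq] using hP.mul_mem h h
  · simpa [sq] using hP.mul_mem h h

theorem one_mem (hP : IsFieldOrdering P) : (1 : K) ∈ P := by
  simpa using hP.sq_mem 1

theorem neg_one_notMem (hP : IsFieldOrdering P) : (-1 : K) ∉ P := fun h =>
  one_ne_zero (hP.eq_zero_of_mem_of_neg_mem hP.one_mem h)

theorem two_ne_zero (hP : IsFieldOrdering P) : (2 : K) ≠ 0 := fun h =>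
  hP.neg_one_notMem (by
    rw [show (-1 : K) = 1 by linear_combination -h]
    exact hP.one_mem)

/-- Two anticommuting invertible `2 × 2` matrices with scalar squares cannot both have negative
squares. -/
theorem mem_or_mem_of_anticommute (hP : IsFieldOrdering P) {α β : K} (hα : α ≠ 0) (hβ : β ≠ 0)
    {I J : Matrix (Fin 2) (Fin 2) K} (hI : I * I = α • 1) (hJ : J * J = β • 1)
    (hIJ : J * I = -(I * J)) : α ∈ P ∨ β ∈ P := by
  by_contra! h
  have hA := (hP.mem_or_neg_mem α).resolve_left h.1
  have hB := (hP.mem_or_neg_mem β).resolve_left h.2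
  have trace_eq_zero {γ : K} {X Y : Matrix (Fin 2) (Fin 2) K} (hγ : γ ≠ 0)
      (hY : Y * Y = γ • 1) (hXY : Y * X = -(X * Y)) : X.trace = 0 := by
    have h₁ : (X * Y * Y).trace = γ * X.trace := by
      rw [mul_assoc, hY]; simp
    have h₂ : (X * Y * Y).trace = -(X * Y * Y).trace := by
      conv_lhs => rw [Matrix.trace_mul_comm, ← mul_assoc, hXY, neg_mul, Matrix.trace_neg]
    have h₃ : 2 * (γ * X.trace) = 0 := by rw [← h₁]; linear_combination h₂
    simpa [hP.two_ne_zero, hγ] using h₃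
  have hI₀ := trace_eq_zero hβ hJ hIJ
  have hJ₀ := trace_eq_zero hα hI (by rw [hIJ, neg_neg])
  have eI := congrFun₂ hI 0 0
  have eJ := congrFun₂ hJ 0 0
  have eIJ := congrFun₂ hIJ 0 0
  simp only [Matrix.trace_fin_two, Matrix.mul_apply, Fin.sum_univ_two, Matrix.smul_apply,
    Matrix.neg_apply, Matrix.one_apply_eq, smul_eq_mul, mul_one] at hI₀ hJ₀ eI eJ eIJ
  have key : -(-α * -β) =
      (I 0 1 * J 1 0 - I 1 0 * J 0 1) ^ 2 + (2 * I 0 0) ^ 2 * -β + (2 * J 0 0) ^ 2 * -α +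
        (1 + 1 + 1) * (-α * -β) := by
    rw [← eI, ← eJ]
    linear_combination (2 * I 0 0 * J 0 0 - I 0 1 * J 1 0 - I 1 0 * J 0 1) * eIJ
  have hAB := hP.mul_mem hA hB
  have hAB' : -(-α * -β) ∈ P := by
    rw [key]
    exact hP.add_mem (hP.add_mem (hP.add_mem (hP.sq_mem _) (hP.mul_mem (hP.sq_mem _) hB))
      (hP.mul_mem (hP.sq_mem _) hA))
      (hP.mul_mem (hP.add_mem (hP.add_mem hP.one_mem hP.one_mem) hP.one_mem) hAB)
  simpa [hα, hβ] using hP.eq_zero_of_mem_of_neg_mem hAB hAB'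

end IsFieldOrdering

namespace QuaternionAlgebra

/-- A quaternionic basis of `M₂(R)` whose `R`-span is everything splits the algebra over `R`. -/
theorem nonempty_baseChange_algEquiv_of_basis {F R : Type*} [Field F] [Field R] [Algebra F R]
    {a b : F} (q : Basis (Matrix (Fin 2) (Fin 2) R) a 0 b)
    (hq : ∀ M, ∃ w x y z : R, w • 1 + x • q.i + y • q.j + z • q.k = M) :
    Nonempty ((R ⊗[F] ℍ[F,a,b]) ≃ₐ[R] Matrix (Fin 2) (Fin 2) R) := by
  let f : (R ⊗[F] ℍ[F,a,b]) →ₐ[R] Matrix (Fin 2) (Fin 2) R := AlgHom.liftEquiv F R _ _ q.liftHom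
  have hs : Function.Surjective f := fun M => by
    obtain ⟨w, x, y, z, rfl⟩ := hq M
    let e : Basis ℍ[F,a,b] a 0 b := Basis.self F
    refine ⟨w ⊗ₜ 1 + x ⊗ₜ e.i + y ⊗ₜ e.j + z ⊗ₜ e.k, ?_⟩
    simp [f, e, Basis.lift]
  have hd : Module.finrank R (R ⊗[F] ℍ[F,a,b]) =
      Module.finrank R (Matrix (Fin 2) (Fin 2) R) := by
    rw [Module.finrank_baseChange, finrank_eq_four, Module.finrank_matrix]
    simp
  have hi : Function.Injective f.toLinearMap :=
    (LinearMap.injective_iff_surjective_of_finrank_eq_finrank hd).mpr hs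
  exact ⟨AlgEquiv.ofBijective f ⟨hi, hs⟩⟩

theorem nonempty_baseChange_algEquiv_of_isSquare {F R : Type*} [Field F] [Field R] [Algebra F R]
    (h2 : (2 : R) ≠ 0) {a b : F} (ha : a ≠ 0) (hb : b ≠ 0)
    (h : IsSquare (algebraMap F R a) ∨ IsSquare (algebraMap F R b)) :
    Nonempty ((R ⊗[F] ℍ[F,a,b]) ≃ₐ[R] Matrix (Fin 2) (Fin 2) R) := by
  have hα : algebraMap F R a ≠ 0 := by simpa using ha
  have hβ : algebraMap F R b ≠ 0 := by simpa using hb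
  rcases h with ⟨t, ht⟩ | ⟨t, ht⟩
  · have h0 : t ≠ 0 := by rintro rfl; simp_all
    refine nonempty_baseChange_algEquiv_of_basis
      { i := !![t, 0; 0, -t]
        j := !![0, algebraMap F R b; 1, 0]
        k := !![0, t * algebraMap F R b; -t, 0]
        i_mul_i := ?_, j_mul_j := ?_, i_mul_j := ?_, j_mul_i := ?_ } fun M =>
      ⟨(M 0 0 + M 1 1) / 2, (M 0 0 - M 1 1) / (2 * t),
        (M 0 1 / algebraMap F R b + M 1 0) / 2,
        (M 0 1 / algebraMap F R b - M 1 0) / (2 * t), ?_⟩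
    all_goals ext i j; fin_cases i <;> fin_cases j <;>
      simp [Algebra.smul_def (A := R), ht] <;> (try field_simp) <;> ring1
  · have h0 : t ≠ 0 := by rintro rfl; simp_all
    refine nonempty_baseChange_algEquiv_of_basis
      { i := !![0, algebraMap F R a; 1, 0]
        j := !![t, 0; 0, -t]
        k := !![0, -(t * algebraMap F R a); t, 0]
        i_mul_i := ?_, j_mul_j := ?_, i_mul_j := ?_, j_mul_i := ?_ } fun M =>
      ⟨(M 0 0 + M 1 1) / 2, (M 0 1 / algebraMap F R a + M 1 0) / 2,
        (M 0 0 - M 1 1) / (2 * t),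
        (M 1 0 - M 0 1 / algebraMap F R a) / (2 * t), ?_⟩
    all_goals ext i j; fin_cases i <;> fin_cases j <;>
      simp [Algebra.smul_def (A := R), ht] <;> (try field_simp) <;> ring1

end QuaternionAlgebra

theorem orderings_of_splitting_field_of_quaternion_algebra
    {F : Type u} [Field F] (hF : IsFormallyRealField F)
    (a b : F) (ha : a ≠ 0) (hb : b ≠ 0)
    (hdiv : ∀ x : ℍ[F,a,b], x ≠ 0 → IsUnit x)
    (K : Type u) [Field K] [Algebra F K]
    (hsplit : Nonempty ((K ⊗[F] ℍ[F,a,b]) ≃ₐ[K] Matrix (Fin 2) (Fin 2) K)) :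
    ∀ P : Set K, IsFieldOrdering P →
      (algebraMap F K a ∈ P ∨ algebraMap F K b ∈ P) ∧
      (¬ ((∀ i : Fin 4, ![1, -a, -b, a * b] i ∈ (algebraMap F K) ⁻¹' P) ∨
          (∀ i : Fin 4, -(![1, -a, -b, a * b] i) ∈ (algebraMap F K) ⁻¹' P))) ∧
      (∀ (R : Type u) [Field R] [Algebra F R],
        IsRealClosureAt F R ((algebraMap F K) ⁻¹' P) → ∃ x : Fin 4 → R, x ≠ 0 ∧
          ∑ i, algebraMap F R (![1, -a, -b, a * b] i) * x i ^ 2 = 0) ∧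
      (∀ (R : Type u) [Field R] [Algebra F R], IsRealClosureAt F R ((algebraMap F K) ⁻¹' P) →
        Nonempty ((R ⊗[F] ℍ[F,a,b]) ≃ₐ[R] Matrix (Fin 2) (Fin 2) R)) := by
  obtain ⟨e⟩ := hsplit
  intro P hP
  have haK : algebraMap F K a ≠ 0 := by simpa using ha
  have hbK : algebraMap F K b ≠ 0 := by simpa using hb
  have hab : algebraMap F K a ∈ P ∨ algebraMap F K b ∈ P := by
    let q : QuaternionAlgebra.Basis (Matrix (Fin 2) (Fin 2) K) a 0 b :=
      (QuaternionAlgebra.Basis.self F).compHom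
        ((e.toAlgHom.restrictScalars F).comp Algebra.TensorProduct.includeRight)
    refine hP.mem_or_mem_of_anticommute haK hbK (I := q.i) (J := q.j) ?_ ?_ ?_
    · rw [q.i_mul_i, zero_smul, add_zero, algebraMap_smul]
    · rw [q.j_mul_j, algebraMap_smul]
    · rw [q.j_mul_i, q.i_mul_j, zero_smul, zero_sub]
  refine ⟨hab, ?_, fun R _ _ hR => ?_, fun R _ _ hR => ?_⟩
  · rintro (h | h)
    · have h₁ : -algebraMap F K a ∈ P := by simpa using h 1
      have h₂ : -algebraMap F K b ∈ P := by simpa using h 2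
      rcases hab with h | h
      · exact haK (hP.eq_zero_of_mem_of_neg_mem h h₁)
      · exact hbK (hP.eq_zero_of_mem_of_neg_mem h h₂)
    · exact hP.neg_one_notMem (by simpa using h 0)
  · rcases hab with h | h
    · obtain ⟨t, ht⟩ := (hR.2.2 a).mpr h
      refine ⟨![t, 1, 0, 0], fun h0 => one_ne_zero (congrFun h0 1), ?_⟩
      simp [Fin.sum_univ_four, ht, sq]
    · obtain ⟨t, ht⟩ := (hR.2.2 b).mpr h
      refine ⟨![t, 0, 1, 0], fun h0 => one_ne_zero (congrFun h0 2), ?_⟩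
      simp [Fin.sum_univ_four, ht, sq]
  · refine QuaternionAlgebra.nonempty_baseChange_algEquiv_of_isSquare (fun h2 => ?_) ha hb
      (hab.imp (hR.2.2 a).mpr (hR.2.2 b).mpr)
    refine hR.2.1.1 1 (fun _ => 1) ?_
    simp only [Fin.sum_univ_one]
    linear_combination h2
end

section
/- Let F be a formally real field, fix an algebraic closure F̄ of F, and let F̃ be the pythagorean closure of F in F̄, i.e., the intersection of all subfields K of F̄ with F ⊆ K such that every sum of two squares of elements of K is a square in K. Let (A,σ) be a central simple F-algebra with involution of the first kind. Then (A ⊗_F F̃, σ ⊗ id_{F̃}) is weakly isotropic if and only if (A,σ) is weakly isotropic. -/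
open scoped TensorProduct

/-- A field is pythagorean if every sum of two squares is a square. -/
def IsPythagoreanField (K : Type*) [Field K] : Prop :=
  ∀ x y : K, IsSquare (x ^ 2 + y ^ 2)

/-- The pythagorean closure of `F` inside its algebraic closure: the intersection of all
pythagorean intermediate fields. -/
noncomputable def pythagoreanClosure (F : Type*) [Field F] :
    IntermediateField F (AlgebraicClosure F) :=
  sInf {K : IntermediateField F (AlgebraicClosure F) | IsPythagoreanField K}

universe u

/-- The system of quadratic forms `∑ c i j k Xᵢ Xⱼ` (indexed by `k`) has a nontrivial family of
vectors with entries in `K` on which its values sum to zero. -/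
def WeaklyIsotropicOver {F Ω ι : Type*} [Field F] [Field Ω] [Algebra F Ω] [Fintype ι]
    (c : ι → ι → ι → F) (K : IntermediateField F Ω) : Prop :=
  ∃ (n : ℕ) (v : Fin n → ι → Ω), (∀ m i, v m i ∈ K) ∧ (∃ m, v m ≠ 0) ∧
    ∀ k, ∑ m, ∑ i, ∑ j, v m i * v m j * algebraMap F Ω (c i j k) = 0

section

variable {F Ω ι : Type*} [Field F] [Field Ω] [Algebra F Ω] [Fintype ι]
  {c : ι → ι → ι → F}

theorem WeaklyIsotropicOver.of_fintype {K : IntermediateField F Ω} {κ : Type*} [Fintype κ]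
    (v : κ → ι → Ω) (hv : ∀ m i, v m i ∈ K) (h0 : ∃ m, v m ≠ 0)
    (h : ∀ k, ∑ m, ∑ i, ∑ j, v m i * v m j * algebraMap F Ω (c i j k) = 0) :
    WeaklyIsotropicOver c K := by
  obtain ⟨m, hm⟩ := h0
  let e := Fintype.equivFin κ
  refine ⟨Fintype.card κ, fun l => v (e.symm l), fun _ _ => hv _ _, ⟨e m, by simpa using hm⟩,
    fun k => ?_⟩
  rw [← h k]
  exact e.symm.sum_comp fun m => ∑ i, ∑ j, v m i * v m j * algebraMap F Ω (c i j k)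

theorem WeaklyIsotropicOver.mono {K L : IntermediateField F Ω} (hKL : K ≤ L)
    (h : WeaklyIsotropicOver c K) : WeaklyIsotropicOver c L := by
  obtain ⟨n, v, hv, h⟩ := h
  exact ⟨n, v, fun m i => hKL (hv m i), h⟩

theorem WeaklyIsotropicOver.exists_mem_of_sSup {S : Set (IntermediateField F Ω)}
    (hS : IsChain (· ≤ ·) S) (hne : S.Nonempty) (h : WeaklyIsotropicOver c (sSup S)) :
    ∃ K ∈ S, WeaklyIsotropicOver c K := by
  obtain ⟨n, v, hv, h⟩ := h
  have : Nonempty S := hne.to_subtype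
  have hdir : Directed (· ≤ ·) (fun K : S => (K : IntermediateField F Ω)) :=
    hS.directedOn.directed_val
  have hmem : ∀ p : Fin n × ι, ∃ K : S, v p.1 p.2 ∈ (K : IntermediateField F Ω) := by
    intro p
    have := hv p.1 p.2
    rwa [sSup_eq_iSup', ← SetLike.mem_coe, IntermediateField.coe_iSup_of_directed hdir,
      Set.mem_iUnion] at this
  choose g hg using hmem
  obtain ⟨K, hK⟩ := hdir.finite_le g
  exact ⟨K, K.2, n, v, fun m i => hK (m, i) (hg (m, i)), h⟩

/-- Every element of `K(s)` with `s ^ 2 ∈ K` has the form `u + w * s` with `u, w ∈ K`. -/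
theorem IntermediateField.exists_eq_add_mul_of_mem_adjoin_sqrt {K : IntermediateField F Ω}
    {s : Ω} (hs : s ^ 2 ∈ K) {x : Ω} (hx : x ∈ IntermediateField.adjoin K {s}) :
    ∃ u ∈ K, ∃ w ∈ K, x = u + w * s := by
  have hint : IsIntegral K s := by
    refine IsIntegral.of_pow (n := 2) (by norm_num) ?_
    exact isIntegral_algebraMap (R := K) (x := ⟨s ^ 2, hs⟩)
  rw [← IntermediateField.mem_toSubalgebra,
    IntermediateField.adjoin_simple_toSubalgebra_of_isAlgebraic hint.isAlgebraic] at hx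
  induction hx using Algebra.adjoin_induction with
  | mem y hy => exact ⟨0, K.zero_mem, 1, K.one_mem, by simpa using hy⟩
  | algebraMap r => exact ⟨r, r.2, 0, K.zero_mem, by simp⟩
  | add y z _ _ hy hz =>
    obtain ⟨u, hu, w, hw, rfl⟩ := hy
    obtain ⟨u', hu', w', hw', rfl⟩ := hz
    exact ⟨u + u', add_mem hu hu', w + w', add_mem hw hw', by ring⟩
  | mul y z _ _ hy hz =>
    obtain ⟨u, hu, w, hw, rfl⟩ := hy
    obtain ⟨u', hu', w', hw', rfl⟩ := hz
    exact ⟨u * u' + w * w' * s ^ 2, add_mem (mul_mem hu hu') (mul_mem (mul_mem hw hw') hs),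
      u * w' + w * u', add_mem (mul_mem hu hw') (mul_mem hw hu'), by ring⟩

/-- Weak isotropy descends along the adjunction of a square root of a sum of two squares. -/
theorem WeaklyIsotropicOver.of_adjoin_sqrt {K : IntermediateField F Ω} {s a b : Ω}
    (ha : a ∈ K) (hb : b ∈ K) (hs : s ^ 2 = a ^ 2 + b ^ 2) (hsK : s ∉ K)
    (h : WeaklyIsotropicOver c ((IntermediateField.adjoin K {s}).restrictScalars F)) :
    WeaklyIsotropicOver c K := by
  have hs2 : s ^ 2 ∈ K := hs ▸ add_mem (pow_mem ha 2) (pow_mem hb 2)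
  obtain ⟨n, v, hv, ⟨m₀, hm₀⟩, h⟩ := h
  have hv' : ∀ m i, ∃ u ∈ K, ∃ w ∈ K, v m i = u + w * s := fun m i =>
    IntermediateField.exists_eq_add_mul_of_mem_adjoin_sqrt hs2 (hv m i)
  choose u hu w hw huw using hv'
  have indep : ∀ x ∈ K, ∀ y ∈ K, x + y * s = 0 → x = 0 := by
    intro x hx y hy hxy
    by_cases hy0 : y = 0
    · simpa [hy0] using hxy
    · refine absurd ?_ hsK
      have : s = -x / y := by
        field_simp
        linear_combination hxy
      exact this ▸ div_mem (neg_mem hx) hy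
  have hc : ∀ i j k, algebraMap F Ω (c i j k) ∈ K := fun i j k => K.algebraMap_mem _
  refine WeaklyIsotropicOver.of_fintype (κ := Fin n ⊕ Fin n ⊕ Fin n)
    (Sum.elim u (Sum.elim (fun m i => a * w m i) (fun m i => b * w m i))) ?_ ?_ ?_
  · rintro (m | m | m) i
    · exact hu m i
    · exact mul_mem ha (hw m i)
    · exact mul_mem hb (hw m i)
  · by_contra! hall
    have h1 : ∀ i, u m₀ i = 0 := congrFun (hall (Sum.inl m₀))
    have h2 : ∀ i, a * w m₀ i = 0 := congrFun (hall (Sum.inr (Sum.inl m₀)))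
    have h3 : ∀ i, b * w m₀ i = 0 := congrFun (hall (Sum.inr (Sum.inr m₀)))
    refine hm₀ (funext fun i => ?_)
    have h4 : (w m₀ i * s) ^ 2 = 0 := by
      linear_combination (w m₀ i) ^ 2 * hs + a * w m₀ i * h2 i + b * w m₀ i * h3 i
    rw [huw, h1, pow_eq_zero_iff two_ne_zero |>.mp h4]
    simp
  · intro k
    refine indep _ ?_ (∑ m, ∑ i, ∑ j, (u m i * w m j + w m i * u m j) *
      algebraMap F Ω (c i j k)) ?_ ?_
    · refine sum_mem fun m _ => sum_mem fun i _ => sum_mem fun j _ =>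
        mul_mem (mul_mem ?_ ?_) (hc i j k) <;> rcases m with m | m | m
      exacts [hu m i, mul_mem ha (hw m i), mul_mem hb (hw m i), hu m j, mul_mem ha (hw m j),
        mul_mem hb (hw m j)]
    · exact sum_mem fun m _ => sum_mem fun i _ => sum_mem fun j _ =>
        mul_mem (add_mem (mul_mem (hu m i) (hw m j)) (mul_mem (hw m i) (hu m j))) (hc i j k)
    · rw [← h k]
      simp only [Fintype.sum_sum_type, Sum.elim_inl, Sum.elim_inr, Finset.sum_mul,
        ← Finset.sum_add_distrib]
      refine Finset.sum_congr rfl fun m _ => Finset.sum_congr rfl fun i _ =>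
        Finset.sum_congr rfl fun j _ => ?_
      rw [huw m i, huw m j]
      linear_combination -(w m i * w m j * algebraMap F Ω (c i j k)) * hs

end

theorem WeaklyIsotropicOver.bot_of_pythagoreanClosure {F ι : Type*} [Field F] [Fintype ι]
    {c : ι → ι → ι → F} (h : WeaklyIsotropicOver c (pythagoreanClosure F)) :
    WeaklyIsotropicOver c (⊥ : IntermediateField F (AlgebraicClosure F)) := by
  by_contra hbot
  obtain ⟨M, -, hM⟩ := zorn_le_nonempty₀
    {K : IntermediateField F (AlgebraicClosure F) | ¬ WeaklyIsotropicOver c K}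
    (fun S hS hchain K hK => ⟨sSup S, fun hsup => by
      obtain ⟨L, hL, hL'⟩ := hsup.exists_mem_of_sSup hchain ⟨K, hK⟩
      exact hS hL hL', fun _ hL => le_sSup hL⟩) ⊥ hbot
  refine hM.prop (h.mono (sInf_le fun a b => ?_))
  obtain ⟨s, hs⟩ := IsAlgClosed.exists_pow_nat_eq
    ((a : AlgebraicClosure F) ^ 2 + (b : AlgebraicClosure F) ^ 2) two_pos
  by_cases hsM : s ∈ M
  · exact ⟨⟨s, hsM⟩, Subtype.ext (by simpa [pow_two] using hs.symm)⟩
  · refine absurd (hM.le_of_ge (y := (IntermediateField.adjoin M {s}).restrictScalars F)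
      (fun hw => hM.prop (hw.of_adjoin_sqrt a.2 b.2 hs hsM)) ?_
      (IntermediateField.mem_adjoin_simple_self M s)) hsM
    exact fun x hx => (IntermediateField.adjoin M {s}).algebraMap_mem ⟨x, hx⟩

section

variable {F A : Type*} [Field F] [Ring A] [Algebra F A] {ι : Type*} [Fintype ι]

theorem WeaklyIsotropicOver.of_baseChange {Ω : Type*} [Field Ω] [Algebra F Ω]
    (b : Module.Basis ι F A) (σ : A →ₗ[F] A) (K : IntermediateField F Ω)
    (h : InvWeaklyIsotropic ⇑(LinearMap.baseChange K σ)) :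
    WeaklyIsotropicOver (fun i j k => b.repr (σ (b i) * b j) k) K := by
  obtain ⟨n, x, hx, h⟩ := h
  let B := b.baseChange K
  refine ⟨n + 1, fun m i => (B.repr (x m) i : Ω), fun m i => SetLike.coe_mem _, ⟨0, fun h0 => ?_⟩,
    fun k => ?_⟩
  · refine hx 0 (B.repr.map_eq_zero_iff.mp (Finsupp.ext fun i => ?_))
    simpa using congrFun h0 i
  · have expand : ∀ m, LinearMap.baseChange K σ (x m) * x m =
        ∑ i, ∑ j, (B.repr (x m) i * B.repr (x m) j) ⊗ₜ[F] (σ (b i) * b j) := by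
      intro m
      have hxm : x m = ∑ i, B.repr (x m) i ⊗ₜ[F] b i := by
        conv_lhs => rw [← B.sum_repr (x m)]
        exact Finset.sum_congr rfl fun i _ => by
          simp [B, Module.Basis.baseChange_apply, TensorProduct.smul_tmul']
      conv_lhs => rw [hxm]
      simp [Finset.sum_mul_sum]
    have hk := congrArg (fun y => ((B.repr y k : K) : Ω)) h
    simp only [expand, map_sum, Finsupp.coe_finsetSum, Finset.sum_apply] at hk
    simpa [B, Module.Basis.baseChange_repr_tmul, Algebra.smul_def, mul_comm] using hk

theorem InvWeaklyIsotropic.of_sum_eq_zero {σ : A → A} {n : ℕ} (x : Fin n → A)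
    (hx : ∃ m, x m ≠ 0) (h : ∑ m, σ (x m) * x m = 0) : InvWeaklyIsotropic σ := by
  classical
  let T := {m // x m ≠ 0}
  obtain ⟨m₀, hm₀⟩ := hx
  have : Nonempty T := ⟨⟨m₀, hm₀⟩⟩
  obtain ⟨k, hk⟩ := Nat.exists_eq_succ_of_ne_zero (Fintype.card_ne_zero (α := T))
  let e : T ≃ Fin (k + 1) := Fintype.equivFinOfCardEq hk
  refine ⟨k, fun l => x (e.symm l), fun l => (e.symm l).2, ?_⟩
  refine (e.symm.sum_comp fun m : T => σ (x m) * x m).trans (Eq.trans ?_ h)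
  refine Finset.sum_bij_ne_zero (fun m _ _ => m) (fun _ _ _ => Finset.mem_univ _)
    (fun _ _ _ _ _ _ => Subtype.ext) (fun m _ hm => ⟨⟨m, ?_⟩, Finset.mem_univ _, hm, rfl⟩)
    (fun _ _ _ => rfl)
  rintro h0
  simp [h0] at hm

theorem WeaklyIsotropicOver.invWeaklyIsotropic {Ω : Type*} [Field Ω] [Algebra F Ω]
    (b : Module.Basis ι F A) (σ : A →ₗ[F] A)
    (h : WeaklyIsotropicOver (fun i j k => b.repr (σ (b i) * b j) k)
      (⊥ : IntermediateField F Ω)) :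
    InvWeaklyIsotropic σ := by
  obtain ⟨n, v, hv, ⟨m, hm⟩, h⟩ := h
  choose r hr using fun m i => IntermediateField.mem_bot.mp (hv m i)
  refine InvWeaklyIsotropic.of_sum_eq_zero (fun m => ∑ i, r m i • b i) ⟨m, ?_⟩ ?_
  · refine fun h0 => hm (funext fun i => ?_)
    rw [← hr, Fintype.linearIndependent_iff.mp b.linearIndependent _ h0 i]
    simp
  · refine b.repr.map_eq_zero_iff.mp (Finsupp.ext fun k => ?_)
    have hk := h k
    simp only [← hr, ← map_mul, ← map_sum] at hk
    rw [map_eq_zero] at hk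
    simpa [Finset.sum_mul_sum, mul_assoc, smul_smul, Finsupp.coe_finsetSum, mul_comm,
      mul_left_comm] using hk

theorem InvWeaklyIsotropic.baseChange {σ : A →ₗ[F] A} (h : InvWeaklyIsotropic σ)
    (K : Type*) [Field K] [Algebra F K] :
    InvWeaklyIsotropic ⇑(LinearMap.baseChange K σ) := by
  obtain ⟨n, x, hx, h⟩ := h
  refine ⟨n, fun m => 1 ⊗ₜ x m, fun m h0 => hx m ?_, ?_⟩
  · exact Algebra.TensorProduct.includeRight_injective (A := K) (R := F) (B := A)
      (algebraMap F K).injective (by simpa using h0)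
  · simp [← TensorProduct.tmul_sum, h]

end

theorem weaklyIsotropic_pythagoreanClosure_iff
    {F : Type u} [Field F] (hF : IsFormallyRealField F)
    {A : Type u} [Ring A] [Algebra F A] [FiniteDimensional F A]
    [Algebra.IsCentral F A] [IsSimpleRing A]
    (σ : A →ₗ[F] A) (hσ : IsInvolutionFirstKind σ) :
    InvWeaklyIsotropic ⇑(LinearMap.baseChange (↥(pythagoreanClosure F)) σ) ↔
      InvWeaklyIsotropic ⇑σ := by
  refine ⟨fun h => ?_, fun h => h.baseChange _⟩
  let b := Module.finBasis F A
  exact (WeaklyIsotropicOver.of_baseChange b σ _ h).bot_of_pythagoreanClosure.invWeaklyIsotropic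
    b σ
end

section
/- Let F be a formally real field, let a, b ∈ F^×, and let D = (a,b)_F be a quaternion division algebra with conjugation γ. Let h = ⟨α₁,…,αₙ⟩ be a diagonal hermitian form over (D,γ) with α₁,…,αₙ ∈ F^×, let A = End_D(Dⁿ) ≅ Mₙ(D), and let σ = ad_h be the adjoint involution of h on A (the unique involution with h(f(x), y) = h(x, σ(f)(y)) for all x, y ∈ Dⁿ and f ∈ A). Then (A,σ) is weakly isotropic over F if and only if the quadratic form ⟨1,−a,−b,ab⟩ ⊗ ⟨α₁,…,αₙ⟩ is weakly isotropic over F. -/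
open Quaternion

/-- Weak isotropy of the diagonal quadratic form with coefficients `c : ι → F`. -/
def DiagQuadWeaklyIsotropic {F : Type*} [Field F] {ι : Type*} [Fintype ι] (c : ι → F) : Prop :=
  ∃ (n : ℕ) (x : Fin (n + 1) → ι → F), x ≠ 0 ∧ ∑ k, ∑ i, c i * x k i ^ 2 = 0

universe u

/-- Zero terms may be omitted when testing weak isotropy. -/
theorem InvWeaklyIsotropic.of_fintype {A ι : Type*} [Ring A] [Fintype ι] {σ : A → A}
    (x : ι → A) (hx : x ≠ 0) (hsum : ∑ i, σ (x i) * x i = 0) : InvWeaklyIsotropic σ := by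
  classical
  obtain ⟨i, hi⟩ := Function.ne_iff.mp hx
  obtain ⟨m, hm⟩ : ∃ m, Fintype.card {i // x i ≠ 0} = m + 1 :=
    Nat.exists_eq_succ_of_ne_zero (Fintype.card_pos_iff.mpr ⟨⟨i, hi⟩⟩).ne'
  let e := Fintype.equivFinOfCardEq hm
  refine ⟨m, fun k => x (e.symm k), fun k => (e.symm k).2, ?_⟩
  rw [e.symm.sum_comp (fun j : {i // x i ≠ 0} => σ (x j) * x j),
    ← Finset.sum_subtype (Finset.univ.filter fun i => x i ≠ 0) (by simp) fun i => σ (x i) * x i]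
  rwa [Finset.sum_filter_of_ne fun i _ h => right_ne_zero_of_mul h]

/-- `γ(w) c w` in terms of the norm form of the quaternion algebra. -/
theorem QuaternionAlgebra.star_mul_algebraMap_mul_self {F : Type*} [Field F] {a b : F} (c : F)
    (w : ℍ[F,a,b]) :
    star w * algebraMap F ℍ[F,a,b] c * w = algebraMap F ℍ[F,a,b]
      (c * (w.re ^ 2 - a * w.imI ^ 2 - b * w.imJ ^ 2 + a * b * w.imK ^ 2)) := by
  simp only [algebraMap_eq]
  ext <;> simp <;> ring

/-- The form `⟨1, -a, -b, ab⟩ ⊗ ⟨α₁, …, αₙ⟩` evaluated at the coordinates of `w`, as the value at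
`(w, w)` of the hermitian form `⟨α₁, …, αₙ⟩`. -/
theorem QuaternionAlgebra.sum_star_mul_algebraMap_mul_self {F ι : Type*} [Field F] [Fintype ι]
    {a b : F} (α : ι → F) (w : ι → ℍ[F,a,b]) :
    ∑ i, star (w i) * algebraMap F ℍ[F,a,b] (α i) * w i = algebraMap F ℍ[F,a,b]
      (∑ p : Fin 4 × ι, ![1, -a, -b, a * b] p.1 * α p.2 *
        ![(w p.2).re, (w p.2).imI, (w p.2).imJ, (w p.2).imK] p.1 ^ 2) := by
  simp only [star_mul_algebraMap_mul_self, ← map_sum, Fintype.sum_prod_type_right]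
  congr 2
  ext i
  simp [Fin.sum_univ_four]
  ring

/-- The endomorphism `v ↦ w vᵢ` of the right vector space `Dⁿ`. -/
def mulCoordEnd {D ι : Type*} [Ring D] (w : ι → D) (i : ι) : Module.End Dᵐᵒᵖ (ι → D) where
  toFun v j := w j * v i
  map_add' u v := by ext j; simp [mul_add]
  map_smul' c v := by ext j; simp [mul_assoc]

theorem mulCoordEnd_apply {D ι : Type*} [Ring D] (w : ι → D) (i : ι) (v : ι → D) (j : ι) :
    mulCoordEnd w i v j = w j * v i := rfl

theorem mulCoordEnd_ne_zero {D ι : Type*} [Ring D] {w : ι → D} (hw : w ≠ 0) (i : ι) :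
    mulCoordEnd w i ≠ 0 := by
  intro h
  refine hw (funext fun j => ?_)
  simpa [mulCoordEnd_apply] using congrFun (LinearMap.congr_fun h fun _ => 1) j

/-- Nondegeneracy of a diagonal hermitian form with nonzero coefficients in `F`. -/
theorem eq_zero_of_forall_sum_star_mul_algebraMap_mul {F D ι : Type*} [Field F] [Ring D]
    [StarRing D] [Algebra F D] [Fintype ι] {α : ι → F} (hα : ∀ i, α i ≠ 0) {z : ι → D}
    (hz : ∀ u : ι → D, ∑ i, star (u i) * algebraMap F D (α i) * z i = 0) : z = 0 := by
  classical
  ext i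
  have h := hz (Pi.single i 1)
  rw [Finset.sum_eq_single i (by intro j _ hj; simp [hj]) (by simp)] at h
  simpa [← Algebra.smul_def, hα i] using h

theorem adjoint_involution_weaklyIsotropic_iff_quadratic
    {F : Type u} [Field F] (hF : IsFormallyRealField F)
    (a b : F) (ha : a ≠ 0) (hb : b ≠ 0)
    (hdiv : ∀ x : ℍ[F,a,b], x ≠ 0 → IsUnit x)
    {n : ℕ} (α : Fin n → F) (hα : ∀ i, α i ≠ 0)
    (σ : Module.End ℍ[F,a,b]ᵐᵒᵖ (Fin n → ℍ[F,a,b]) →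
      Module.End ℍ[F,a,b]ᵐᵒᵖ (Fin n → ℍ[F,a,b]))
    (hadj : ∀ (f : Module.End ℍ[F,a,b]ᵐᵒᵖ (Fin n → ℍ[F,a,b])) (x y : Fin n → ℍ[F,a,b]),
      ∑ i, star (f x i) * algebraMap F ℍ[F,a,b] (α i) * y i =
        ∑ i, star (x i) * algebraMap F ℍ[F,a,b] (α i) * (σ f) y i) :
    InvWeaklyIsotropic σ ↔
      DiagQuadWeaklyIsotropic (fun p : Fin 4 × Fin n => ![1, -a, -b, a * b] p.1 * α p.2) := by
  have hinj : Function.Injective (algebraMap F ℍ[F,a,b]) := FaithfulSMul.algebraMap_injective _ _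
  have hsum {m : ℕ} (f : Fin m → Module.End ℍ[F,a,b]ᵐᵒᵖ (Fin n → ℍ[F,a,b]))
      (u v : Fin n → ℍ[F,a,b]) :
      ∑ k, ∑ i, star (f k u i) * algebraMap F ℍ[F,a,b] (α i) * f k v i =
        ∑ i, star (u i) * algebraMap F ℍ[F,a,b] (α i) * (∑ k, σ (f k) * f k) v i := by
    simp only [hadj, LinearMap.sum_apply, Finset.sum_apply, Finset.mul_sum, Module.End.mul_apply]
    exact Finset.sum_comm
  constructor
  · rintro ⟨m, f, hf, hf0⟩
    obtain ⟨v, hv⟩ := DFunLike.ne_iff.mp (hf 0)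
    obtain ⟨i, hi⟩ := Function.ne_iff.mp hv
    refine ⟨m, fun k p => ![(f k v p.2).re, (f k v p.2).imI, (f k v p.2).imJ, (f k v p.2).imK] p.1,
      fun h => hi ?_, hinj ?_⟩
    · have h' (j : Fin 4) := congrFun (congrFun h 0) (j, i)
      ext
      · exact h' 0
      · exact h' 1
      · exact h' 2
      · exact h' 3
    · simp only [map_sum (algebraMap F ℍ[F,a,b]) _ (Finset.univ : Finset (Fin (m + 1))),
        ← QuaternionAlgebra.sum_star_mul_algebraMap_mul_self, map_zero]
      rw [hsum, hf0]
      simp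
  · rintro ⟨m, x, hx, hx0⟩
    obtain ⟨k₀, hk₀⟩ := Function.ne_iff.mp hx
    obtain ⟨⟨j₀, i₀⟩, hp⟩ := Function.ne_iff.mp hk₀
    let w (k : Fin (m + 1)) (i : Fin n) : ℍ[F,a,b] := ⟨x k (0, i), x k (1, i), x k (2, i), x k (3, i)⟩
    have hxw (k : Fin (m + 1)) (p : Fin 4 × Fin n) :
        x k p = ![(w k p.2).re, (w k p.2).imI, (w k p.2).imJ, (w k p.2).imK] p.1 := by
      obtain ⟨j, i⟩ := p
      fin_cases j <;> rfl
    have hw : ∑ k, ∑ i, star (w k i) * algebraMap F ℍ[F,a,b] (α i) * w k i = 0 := by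
      simp only [hxw] at hx0
      simp only [QuaternionAlgebra.sum_star_mul_algebraMap_mul_self, ← map_sum, hx0, map_zero]
    have hwk : w k₀ ≠ 0 := by
      intro h
      refine hp ?_
      rw [hxw, h]
      fin_cases j₀ <;> rfl
    refine .of_fintype (fun k => mulCoordEnd (w k) i₀)
      (fun h => mulCoordEnd_ne_zero hwk i₀ (congrFun h k₀)) (LinearMap.ext fun v => ?_)
    refine eq_zero_of_forall_sum_star_mul_algebraMap_mul hα fun u => ?_
    rw [← hsum]
    calc _ = star (u i₀) *
          (∑ k, ∑ i, star (w k i) * algebraMap F ℍ[F,a,b] (α i) * w k i) * v i₀ := by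
          simp only [mulCoordEnd_apply, star_mul, Finset.mul_sum, Finset.sum_mul, mul_assoc]
      _ = 0 := by rw [hw, mul_zero, zero_mul]
end
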